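/- arXiv:2604.26832 — 5 statements merged into one kernel-verified Lean document; each statement's English description precedes it below -/
import Mathlib

section
/- For every n ≥ 1, the number of primitive two-dimensional binary words of dimension 2 × n equals ∑_{d ∣ n} μ(d) (4^{n/d} − 2^{n/d}), where μ is the Möbius function. -/
open scoped BigOperators

noncomputable section

/-- A word `w : Fin n → Fin 4` is primitive if it is not a proper power,
i.e. there is no `d` with `0 < d < n`, `d ∣ n`, and `w j = w (j mod d)` for all `j`. -/
def Prim1D (n : ℕ) (w : Fin n → Fin 4) : Prop :=
  ¬ ∃ (d : ℕ) (hd : 0 < d) (hdn : d < n), d ∣ n ∧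
      ∀ j : Fin n, w j = w ⟨j.val % d, Nat.lt_trans (Nat.mod_lt _ hd) hdn⟩

/-- A two-dimensional binary word `W : Fin 2 → Fin n → Fin 2` is primitive if there are no
positive `p ∣ 2` and `q ∣ n` with `(p, q) ≠ (2, n)` such that
`W i j = W (i mod p) (j mod q)` for all `i, j`. -/
def Prim2D (n : ℕ) (W : Fin 2 → Fin n → Fin 2) : Prop :=
  ¬ ∃ (p q : ℕ) (hp : 0 < p) (hq : 0 < q) (hpd : p ∣ 2) (hqd : q ∣ n),
      (p ≠ 2 ∨ q ≠ n) ∧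
      ∀ (i : Fin 2) (j : Fin n),
        W i j = W ⟨i.val % p, Nat.lt_of_lt_of_le (Nat.mod_lt _ hp)
                      (Nat.le_of_dvd (by norm_num) hpd)⟩
                  ⟨j.val % q, Nat.lt_of_lt_of_le (Nat.mod_lt _ hq)
                      (Nat.le_of_dvd j.pos hqd)⟩

/-- The substitution `η` sending each symbol of `Γ = {0, 1, 2, 3}` to a column of height 2:
`0 ↦ (0,1)`, `1 ↦ (0,0)`, `2 ↦ (1,1)`, `3 ↦ (1,0)` (read top-to-bottom). -/
def eta : Fin 4 → Fin 2 → Fin 2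
  | 0 => ![0, 1]
  | 1 => ![0, 0]
  | 2 => ![1, 1]
  | 3 => ![1, 0]

/-- The extension `η̂` of `η` sending a word `w : Fin n → Fin 4` to the `2 × n`
two-dimensional binary word whose `j`-th column is `η (w j)`. -/
def etaHat {n : ℕ} (w : Fin n → Fin 4) : Fin 2 → Fin n → Fin 2 :=
  fun i j => eta (w j) i

/-- `U_n`: primitive words of length `n` over `Γ = {0,1,2,3}` containing a `0` or a `3`. -/
def Uset (n : ℕ) : Set (Fin n → Fin 4) :=
  {w | Prim1D n w ∧ ∃ j : Fin n, w j = 0 ∨ w j = 3}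

/-- `W_n`: primitive two-dimensional binary words of dimension `2 × n`. -/
def Wset (n : ℕ) : Set (Fin 2 → Fin n → Fin 2) :=
  {W | Prim2D n W}

/-- The left shift on infinite words. -/
def shift {α : Type*} (s : ℕ → α) : ℕ → α := fun k => s (k + 1)

theorem shift_iterate {α : Type*} (m : ℕ) (s : ℕ → α) : shift^[m] s = fun k => s (k + m) := by
  induction m generalizing s with
  | zero => rfl
  | succ m ih =>
    rw [Function.iterate_succ_apply, ih]
    funext k
    simp only [shift, add_assoc]

theorem isPeriodicPt_shift_iff {α : Type*} {m : ℕ} {s : ℕ → α} :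
    Function.IsPeriodicPt shift m s ↔ Function.Periodic s m := by
  rw [Function.IsPeriodicPt, Function.IsFixedPt, shift_iterate, funext_iff]
  rfl

/-- The infinite word obtained by repeating a nonempty finite word. -/
def periodize {α : Type*} {n : ℕ} (hn : 0 < n) (w : Fin n → α) : ℕ → α :=
  fun k => w ⟨k % n, Nat.mod_lt _ hn⟩

theorem periodize_val {α : Type*} {n : ℕ} (hn : 0 < n) (w : Fin n → α) (j : Fin n) :
    periodize hn w j = w j :=
  congrArg w (Fin.ext (Nat.mod_eq_of_lt j.isLt))

theorem periodize_injective {α : Type*} {n : ℕ} (hn : 0 < n) :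
    Function.Injective (periodize (α := α) hn) := fun v w h =>
  funext fun j => by rw [← periodize_val hn v, h, periodize_val]

theorem isPeriodicPt_periodize {α : Type*} {n : ℕ} (hn : 0 < n) (w : Fin n → α) :
    Function.IsPeriodicPt shift n (periodize hn w) :=
  isPeriodicPt_shift_iff.2 fun k => congrArg w (Fin.ext (Nat.add_mod_right k n))

theorem exists_periodize_eq {α : Type*} {n : ℕ} (hn : 0 < n) {s : ℕ → α}
    (hs : Function.IsPeriodicPt shift n s) : ∃ w : Fin n → α, periodize hn w = s :=
  ⟨fun j => s j, funext fun k => (isPeriodicPt_shift_iff.1 hs).map_mod_nat k⟩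

theorem isPeriodicPt_periodize_iff {α : Type*} {n q : ℕ} (hn : 0 < n) (hq : 0 < q) (hqn : q ∣ n)
    (w : Fin n → α) :
    Function.IsPeriodicPt shift q (periodize hn w) ↔
      ∀ j : Fin n, w j = w ⟨j % q, (Nat.mod_lt _ hq).trans_le (Nat.le_of_dvd hn hqn)⟩ := by
  rw [isPeriodicPt_shift_iff]
  constructor
  · intro h j
    have h' := h.map_mod_nat j
    rw [periodize_val] at h'
    rw [← h']
    exact periodize_val hn w ⟨j % q, (Nat.mod_lt _ hq).trans_le (Nat.le_of_dvd hn hqn)⟩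
  · intro h k
    simp only [periodize]
    rw [h, h ⟨k % n, _⟩]
    simp only [Nat.mod_mod_of_dvd _ hqn, Nat.add_mod_right]

/-- The infinite words of columns having some column with two distinct entries. -/
def rowsDiffer : Set (ℕ → Fin 2 → Fin 2) := {s | ∃ k, s k 0 ≠ s k 1}

theorem periodize_mem_rowsDiffer_iff {n : ℕ} (hn : 0 < n) (w : Fin n → Fin 2 → Fin 2) :
    periodize hn w ∈ rowsDiffer ↔ ∃ j, w j 0 ≠ w j 1 := by
  constructor
  · rintro ⟨k, hk⟩
    exact ⟨_, hk⟩
  · rintro ⟨j, hj⟩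
    exact ⟨j, by rwa [periodize_val]⟩

theorem prim2D_iff {n : ℕ} (hn : 0 < n) (W : Fin 2 → Fin n → Fin 2) :
    Prim2D n W ↔ Function.minimalPeriod shift (periodize hn (Function.swap W)) = n ∧
      periodize hn (Function.swap W) ∈ rowsDiffer := by
  rw [periodize_mem_rowsDiffer_iff]
  have hper := isPeriodicPt_periodize hn (Function.swap W)
  constructor
  · intro h
    refine ⟨?_, ?_⟩
    · by_contra hne
      have hpos := hper.minimalPeriod_pos hn
      have hdvd := hper.minimalPeriod_dvd
      have hmin := (isPeriodicPt_periodize_iff hn hpos hdvd _).1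
        (Function.isPeriodicPt_minimalPeriod shift (periodize hn (Function.swap W)))
      refine h ⟨2, _, two_pos, hpos, dvd_rfl, hdvd, Or.inr hne, fun i j => ?_⟩
      have hi : (⟨i % 2, Nat.mod_lt _ two_pos⟩ : Fin 2) = i :=
        Fin.ext (Nat.mod_eq_of_lt i.isLt)
      exact (congrFun (hmin j) i).trans (by rw [hi])
    · by_contra! hrows
      refine h ⟨1, n, one_pos, hn, one_dvd 2, dvd_rfl, Or.inl (by norm_num), fun i j => ?_⟩
      simp only [Nat.mod_one, Nat.mod_eq_of_lt j.isLt]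
      fin_cases i
      · rfl
      · exact (hrows j).symm
  · rintro ⟨hmin, j, hj⟩ ⟨p, q, hp, hq, hpd, hqd, hne, hW⟩
    rcases (Nat.dvd_prime Nat.prime_two).1 hpd with rfl | rfl
    · apply hj
      simp only [Function.swap, hW 0 j, hW 1 j, Nat.mod_one]
    · have hqn : q ≠ n := by simpa using hne
      refine hqn (Nat.dvd_antisymm hqd ?_)
      have hq' : Function.IsPeriodicPt shift q (periodize hn (Function.swap W)) := by
        refine (isPeriodicPt_periodize_iff hn hq hqd _).2 fun j => funext fun i => ?_
        have hi : (⟨i % 2, Nat.mod_lt _ two_pos⟩ : Fin 2) = i :=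
          Fin.ext (Nat.mod_eq_of_lt i.isLt)
        exact (hW i j).trans (by rw [hi])
      simpa only [hmin] using hq'.minimalPeriod_dvd

theorem card_prim2D {n : ℕ} (hn : 0 < n) :
    Nat.card {W : Fin 2 → Fin n → Fin 2 // Prim2D n W} =
      {s ∈ rowsDiffer | Function.minimalPeriod shift s = n}.ncard := by
  refine Nat.card_congr (Equiv.ofBijective
    (fun W => ⟨periodize hn (Function.swap W.1), ((prim2D_iff hn _).1 W.2).symm⟩) ⟨?_, ?_⟩)
  · intro V W h
    exact Subtype.ext (congrArg Function.swap (periodize_injective hn (Subtype.mk.inj h)))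
  · rintro ⟨s, hs, hmin⟩
    have hper : Function.IsPeriodicPt shift n s :=
      Function.isPeriodicPt_iff_minimalPeriod_dvd.2 hmin.dvd
    obtain ⟨w, rfl⟩ := exists_periodize_eq hn hper
    exact ⟨⟨Function.swap w, (prim2D_iff hn _).2 ⟨hmin, hs⟩⟩, rfl⟩

theorem card_words_rows_differ (n : ℕ) :
    ((Finset.univ.filter fun w : Fin n → Fin 2 → Fin 2 => ∃ j, w j 0 ≠ w j 1).card : ℤ) =
      4 ^ n - 2 ^ n := by
  have hcompl : (Finset.univ.filter fun w : Fin n → Fin 2 → Fin 2 => ¬ ∃ j, w j 0 ≠ w j 1) =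
      Fintype.piFinset fun _ => Finset.univ.filter fun c : Fin 2 → Fin 2 => c 0 = c 1 := by
    ext w
    simp [Fintype.mem_piFinset]
  have hcol : (Finset.univ.filter fun c : Fin 2 → Fin 2 => c 0 = c 1).card = 2 := by decide
  have h := Finset.card_filter_add_card_filter_not (s := Finset.univ)
    (fun w : Fin n → Fin 2 → Fin 2 => ∃ j, w j 0 ≠ w j 1)
  rw [hcompl, Fintype.card_piFinset_const, hcol, Finset.card_univ] at h
  simp only [Fintype.card_pi, Fintype.card_fin, Finset.prod_const, Finset.card_univ] at h
  norm_num at h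
  rw [eq_sub_iff_add_eq]
  exact_mod_cast h

theorem sum_card_prim2D {n : ℕ} (hn : 0 < n) :
    ∑ d ∈ n.divisors, (Nat.card {W : Fin 2 → Fin d → Fin 2 // Prim2D d W} : ℤ) =
      4 ^ n - 2 ^ n := by
  classical
  set T := (Finset.univ.filter fun w : Fin n → Fin 2 → Fin 2 => ∃ j, w j 0 ≠ w j 1).image
    (periodize hn) with hT
  have hmem (s : ℕ → Fin 2 → Fin 2) :
      s ∈ T ↔ s ∈ rowsDiffer ∧ Function.minimalPeriod shift s ∣ n := by
    rw [← Function.isPeriodicPt_iff_minimalPeriod_dvd]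
    simp only [hT, Finset.mem_image, Finset.mem_filter, Finset.mem_univ, true_and,
      ← periodize_mem_rowsDiffer_iff hn]
    constructor
    · rintro ⟨w, hw, rfl⟩
      exact ⟨hw, isPeriodicPt_periodize hn w⟩
    · rintro ⟨hs, hper⟩
      obtain ⟨w, rfl⟩ := exists_periodize_eq hn hper
      exact ⟨w, hs, rfl⟩
  rw [← card_words_rows_differ, ← Finset.card_image_of_injective _ (periodize_injective hn), ← hT,
    Finset.card_eq_sum_card_fiberwise (f := Function.minimalPeriod shift) (t := n.divisors)
      fun s hs => Nat.mem_divisors.2 ⟨((hmem s).1 hs).2, hn.ne'⟩, Nat.cast_sum]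
  refine Finset.sum_congr rfl fun d hd => ?_
  rw [card_prim2D (Nat.pos_of_mem_divisors hd), ← Set.ncard_coe_finset]
  congr 2
  ext s
  simp only [Set.mem_ofPred_eq, Finset.coe_filter, hmem]
  constructor
  · rintro ⟨hs, rfl⟩
    exact ⟨⟨hs, Nat.dvd_of_mem_divisors hd⟩, rfl⟩
  · rintro ⟨⟨hs, -⟩, h⟩
    exact ⟨hs, h⟩

/-- For every `n ≥ 1`, the number of primitive two-dimensional binary words of dimension
`2 × n` equals `∑_{d ∣ n} μ(d) (4^{n/d} − 2^{n/d})`. -/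
theorem stmt2 (n : ℕ) (hn : 1 ≤ n) :
    (Nat.card {W : Fin 2 → Fin n → Fin 2 // Prim2D n W} : ℤ) =
      ∑ d ∈ n.divisors,
        (ArithmeticFunction.moebius d : ℤ) * (4 ^ (n / d) - 2 ^ (n / d)) := by
  have h := ArithmeticFunction.sum_eq_iff_sum_mul_moebius_eq.1
    (fun m hm => sum_card_prim2D (n := m) hm) n hn
  rw [← h, ← Nat.sum_divisorsAntidiagonal
    (f := fun d e => (ArithmeticFunction.moebius d : ℤ) * (4 ^ e - 2 ^ e))]
  simp only [Int.cast_id]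
end
end

section
/- Let n ≥ 1 and let w : Fin n → Fin 4 be a word of length n over the alphabet Γ = {0, 1, 2, 3}. Then the two-dimensional binary word η̂(w) of dimension 2 × n is primitive if and only if w is a primitive word and w(j) ∈ {0, 3} for some j. -/
open scoped BigOperators

noncomputable section

lemma eta_injective : Function.Injective eta := by
  decide

lemma eta_zero_eq_eta_one_iff (a : Fin 4) : eta a 0 = eta a 1 ↔ ¬ (a = 0 ∨ a = 3) := by
  revert a
  decide

/-- For `n ≥ 1` and a word `w : Fin n → Fin 4`, the two-dimensional word `η̂(w)` is
primitive iff `w` is primitive and `w(j) ∈ {0, 3}` for some `j`. -/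
theorem stmt3 (n : ℕ) (hn : 1 ≤ n) (w : Fin n → Fin 4) :
    Prim2D n (etaHat w) ↔ Prim1D n w ∧ ∃ j : Fin n, w j = 0 ∨ w j = 3 := by
  constructor
  · intro h
    constructor
    · rintro ⟨d, hd, hdn, hdvd, hw⟩
      refine h ⟨2, d, two_pos, hd, dvd_rfl, hdvd, Or.inr hdn.ne, fun i j => ?_⟩
      have hi : (⟨i.val % 2, Nat.mod_lt _ two_pos⟩ : Fin 2) = i :=
        Fin.ext (Nat.mod_eq_of_lt i.isLt)
      simp only [etaHat, hi]
      rw [hw j]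
    · by_contra hno
      refine h ⟨1, n, one_pos, hn, one_dvd 2, dvd_rfl, Or.inl (by decide), fun i j => ?_⟩
      have hj := (eta_zero_eq_eta_one_iff (w j)).2 fun hj => hno ⟨j, hj⟩
      have hjn : (⟨j.val % n, Nat.mod_lt _ hn⟩ : Fin n) = j :=
        Fin.ext (Nat.mod_eq_of_lt j.isLt)
      simp only [etaHat, hjn, Nat.mod_one]
      fin_cases i
      · rfl
      · exact hj.symm
  · rintro ⟨hprim, j, hj⟩ ⟨p, q, hp, hq, hpd, hqd, hne, hW⟩
    rcases (Nat.dvd_prime Nat.prime_two).1 hpd with rfl | rfl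
    · refine (eta_zero_eq_eta_one_iff (w j)).1 ?_ hj
      exact (hW 0 j).trans (hW 1 j).symm
    · have hqn : q < n :=
        lt_of_le_of_ne (Nat.le_of_dvd hn hqd) (hne.resolve_left fun h => h rfl)
      refine hprim ⟨q, hq, hqn, hqd, fun k => eta_injective (funext fun i => ?_)⟩
      have hi : (⟨i.val % 2, Nat.mod_lt _ two_pos⟩ : Fin 2) = i :=
        Fin.ext (Nat.mod_eq_of_lt i.isLt)
      have hik := hW i k
      simp only [etaHat, hi] at hik
      exact hik
end
end

section
/- The sorted pedal map P maps C* into C: for every p ∈ C*, the triple P(p) satisfies a ≥ b ≥ c > 0 and a + b + c = 1. -/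
open scoped BigOperators

noncomputable section

/-- `C̄`: sorted triples `(a, b, c)` with `a ≥ b ≥ c ≥ 0` and `a + b + c = 1`. -/
def Cbar : Set (ℝ × ℝ × ℝ) :=
  {p | p.1 ≥ p.2.1 ∧ p.2.1 ≥ p.2.2 ∧ p.2.2 ≥ 0 ∧ p.1 + p.2.1 + p.2.2 = 1}

/-- `C`: non-degenerate sorted triples `(a, b, c)` with `a ≥ b ≥ c > 0` and `a + b + c = 1`. -/
def Cset : Set (ℝ × ℝ × ℝ) :=
  {p | p.1 ≥ p.2.1 ∧ p.2.1 ≥ p.2.2 ∧ p.2.2 > 0 ∧ p.1 + p.2.1 + p.2.2 = 1}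

/-- `C*`: the sorted triples in `C` with `a ≠ 1/2`. -/
def Cstar : Set (ℝ × ℝ × ℝ) :=
  {p ∈ Cset | p.1 ≠ 1/2}

/-- The four regions `R₀, R₁, R₂, R₃` partitioning `C*`. -/
def Rset : Fin 4 → Set (ℝ × ℝ × ℝ)
  | 0 => {p ∈ Cstar | p.1 < 1/2}
  | 1 => {p ∈ Cstar | p.1 > 1/2 ∧ 2*p.1 - 1 ≥ 2*p.2.1}
  | 2 => {p ∈ Cstar | p.1 > 1/2 ∧ 2*p.2.1 > 2*p.1 - 1 ∧ 2*p.1 - 1 ≥ 2*p.2.2}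
  | 3 => {p ∈ Cstar | p.1 > 1/2 ∧ 2*p.2.2 > 2*p.1 - 1}

/-- The sorted pedal map `P` (extended to a total map on `ℝ³` by the same case analysis;
on `R₀, R₁, R₂, R₃` it is given by the four branch formulas). -/
def pedal (p : ℝ × ℝ × ℝ) : ℝ × ℝ × ℝ :=
  if p.1 < 1/2 then (1 - 2*p.2.2, 1 - 2*p.2.1, 1 - 2*p.1)
  else if 2*p.1 - 1 ≥ 2*p.2.1 then (2*p.1 - 1, 2*p.2.1, 2*p.2.2)
  else if 2*p.1 - 1 ≥ 2*p.2.2 then (2*p.2.1, 2*p.1 - 1, 2*p.2.2)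
  else (2*p.2.1, 2*p.2.2, 2*p.1 - 1)

/-- The four inverse branches `I₀, I₁, I₂, I₃` of the sorted pedal map. -/
def Ibr : Fin 4 → ℝ × ℝ × ℝ → ℝ × ℝ × ℝ
  | 0, p => ((1 - p.2.2)/2, (1 - p.2.1)/2, (1 - p.1)/2)
  | 1, p => ((p.1 + 1)/2, p.2.1/2, p.2.2/2)
  | 2, p => ((p.2.1 + 1)/2, p.1/2, p.2.2/2)
  | 3, p => ((p.2.2 + 1)/2, p.1/2, p.2.1/2)

/-- The composed inverse branch `I_w = I_{w₀} ∘ I_{w₁} ∘ ⋯ ∘ I_{w_{m−1}}`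
(composition applied from right to left). -/
def Icomp : (m : ℕ) → (Fin m → Fin 4) → ℝ × ℝ × ℝ → ℝ × ℝ × ℝ
  | 0, _, p => p
  | m + 1, w, p => Ibr (w 0) (Icomp m (fun j => w j.succ) p)

/-- The Euclidean distance on `ℝ³` (represented as `ℝ × ℝ × ℝ`). -/
def eudist (p q : ℝ × ℝ × ℝ) : ℝ :=
  Real.sqrt ((p.1 - q.1)^2 + (p.2.1 - q.2.1)^2 + (p.2.2 - q.2.2)^2)

/-- `T_n`: sorted triples of exact pedal period `n`. -/
def Tset (n : ℕ) : Set (ℝ × ℝ × ℝ) :=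
  {p | p ∈ Cset ∧ (∀ j, j < n → pedal^[j] p ∈ Cstar) ∧ pedal^[n] p = p ∧
       ∀ d, 1 ≤ d → d < n → pedal^[d] p ≠ p}

/-- `w : Fin n → Fin 4` is the branch itinerary of `p`: `P^j(p) ∈ R_{w_j}` for `0 ≤ j < n`. -/
def Itinerary (n : ℕ) (p : ℝ × ℝ × ℝ) (w : Fin n → Fin 4) : Prop :=
  ∀ j : Fin n, pedal^[j.val] p ∈ Rset (w j)

/-- The sorted pedal map maps `C*` into `C`. -/
theorem stmt6 : ∀ p ∈ Cstar, pedal p ∈ Cset := by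
  rintro ⟨a, b, c⟩ ⟨⟨hab, hbc, hc, hsum⟩, ha⟩
  dsimp only at hab hbc hc hsum ha
  have hsplit : a < 1/2 ∨ 1/2 < a := lt_or_gt_of_ne ha
  simp only [pedal, Cset, Set.mem_ofPred_eq]
  split_ifs <;> refine ⟨?_, ?_, ?_, ?_⟩ <;> grind
end
end

section
/- Let n ≥ 1 and let p ∈ T_n with branch itinerary w = w₀w₁…w_{n−1} (so P^j(p) ∈ R_{w_j} for all 0 ≤ j < n). Then w is not a word over {1, 2} alone; that is, there exists some j with w_j ∈ {0, 3}. -/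
open scoped BigOperators

noncomputable section

/-- On `R₁` and `R₂` the sorted pedal map doubles the smallest coordinate. -/
theorem pedal_snd_snd {q : ℝ × ℝ × ℝ} {i : Fin 4} (hq : q ∈ Rset i) (h0 : i ≠ 0) (h3 : i ≠ 3) :
    (pedal q).2.2 = 2 * q.2.2 := by
  fin_cases i
  · exact absurd rfl h0
  · obtain ⟨-, ha, hb⟩ := hq
    simp only [pedal, if_neg ha.le.not_gt, if_pos hb]
  · obtain ⟨-, ha, hb, hc⟩ := hq
    simp only [pedal, if_neg ha.le.not_gt, if_neg hb.not_ge, if_pos hc]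
  · exact absurd rfl h3

/-- If `p ∈ T_n` has branch itinerary `w`, then `w` is not a word over `{1, 2}` alone:
some letter of `w` is `0` or `3`. -/
theorem stmt15 (n : ℕ) (hn : 1 ≤ n) (p : ℝ × ℝ × ℝ) (hp : p ∈ Tset n)
    (w : Fin n → Fin 4) (hw : Itinerary n p w) :
    ∃ j : Fin n, w j = 0 ∨ w j = 3 := by
  by_contra! h
  obtain ⟨⟨-, -, hc, -⟩, -, hper, -⟩ := hp
  have key : ∀ k ≤ n, (pedal^[k] p).2.2 = 2 ^ k * p.2.2 := by
    intro k
    induction k with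
    | zero => simp
    | succ k ih =>
      intro hk
      rw [Function.iterate_succ_apply', pedal_snd_snd (hw ⟨k, hk⟩) (h _).1 (h _).2,
        ih (Nat.le_of_succ_le hk)]
      ring
  have hn' := key n le_rfl
  rw [hper] at hn'
  have hpow : (1 : ℝ) < 2 ^ n := one_lt_pow₀ one_lt_two (Nat.one_le_iff_ne_zero.mp hn)
  exact (lt_mul_of_one_lt_left hc hpow).ne hn'
end
end

section
/- Let n ≥ 1 and let p ∈ T_n with branch itinerary w = w₀w₁…w_{n−1} (so P^j(p) ∈ R_{w_j} for all 0 ≤ j < n). Then w is a primitive word over Γ = {0, 1, 2, 3}: there is no d with 0 < d < n, d ∣ n, and w_j = w_{j mod d} for all j. -/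
open scoped BigOperators

noncomputable section

/-- The squared Euclidean distance on `ℝ³`. -/
def sqDist (x y : ℝ × ℝ × ℝ) : ℝ :=
  (x.1 - y.1)^2 + (x.2.1 - y.2.1)^2 + (x.2.2 - y.2.2)^2

theorem eq_of_sqDist_eq_zero {x y : ℝ × ℝ × ℝ} (h : sqDist x y = 0) : x = y := by
  unfold sqDist at h
  have h₁ := sq_nonneg (x.1 - y.1)
  have h₂ := sq_nonneg (x.2.1 - y.2.1)
  have h₃ := sq_nonneg (x.2.2 - y.2.2)
  refine Prod.ext ?_ (Prod.ext ?_ ?_) <;>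
    exact sub_eq_zero.mp (pow_eq_zero_iff two_ne_zero |>.mp (by linarith))

/-- Each branch of the pedal map is a similarity of ratio `2`. -/
theorem sqDist_pedal {a : Fin 4} {x y : ℝ × ℝ × ℝ} (hx : x ∈ Rset a) (hy : y ∈ Rset a) :
    sqDist (pedal x) (pedal y) = 4 * sqDist x y := by
  fin_cases a
  · obtain ⟨-, hx⟩ := hx
    obtain ⟨-, hy⟩ := hy
    simp only [sqDist, pedal, if_pos hx, if_pos hy]
    ring
  · obtain ⟨-, hx, hx'⟩ := hx
    obtain ⟨-, hy, hy'⟩ := hy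
    simp only [sqDist, pedal, if_neg hx.not_gt, if_pos hx', if_neg hy.not_gt, if_pos hy']
    ring
  · obtain ⟨-, hx, hx', hx''⟩ := hx
    obtain ⟨-, hy, hy', hy''⟩ := hy
    simp only [sqDist, pedal, if_neg hx.not_gt, if_neg hx'.not_ge, if_pos hx'',
      if_neg hy.not_gt, if_neg hy'.not_ge, if_pos hy'']
    ring
  · obtain ⟨⟨⟨-, hx₁, -⟩, -⟩, hx, hx'⟩ := hx
    obtain ⟨⟨⟨-, hy₁, -⟩, -⟩, hy, hy'⟩ := hy
    have hxb : ¬ 2*x.1 - 1 ≥ 2*x.2.1 := by linarith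
    have hyb : ¬ 2*y.1 - 1 ≥ 2*y.2.1 := by linarith
    simp only [sqDist, pedal, if_neg hx.not_gt, if_neg hxb, if_neg hx'.not_ge,
      if_neg hy.not_gt, if_neg hyb, if_neg hy'.not_ge]
    ring

theorem sqDist_iterate_pedal {x y : ℝ × ℝ × ℝ} (v : ℕ → Fin 4)
    (hx : ∀ k, pedal^[k] x ∈ Rset (v k)) (hy : ∀ k, pedal^[k] y ∈ Rset (v k)) (k : ℕ) :
    sqDist (pedal^[k] x) (pedal^[k] y) = 4 ^ k * sqDist x y := by
  induction k with
  | zero => simp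
  | succ k ih =>
    rw [Function.iterate_succ_apply', Function.iterate_succ_apply', sqDist_pedal (hx k) (hy k),
      ih, pow_succ]
    ring

/-- If `p ∈ T_n` has branch itinerary `w`, then `w` is a primitive word over `Γ`. -/
theorem stmt16 (n : ℕ) (hn : 1 ≤ n) (p : ℝ × ℝ × ℝ) (hp : p ∈ Tset n)
    (w : Fin n → Fin 4) (hw : Itinerary n p w) :
    Prim1D n w := by
  rintro ⟨d, hd, hdn, hdvd, hwd⟩
  obtain ⟨-, -, hper, hmin⟩ := hp
  have hper' : Function.IsPeriodicPt pedal n p := hper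
  let v : ℕ → Fin 4 := fun k => w ⟨k % d, (Nat.mod_lt _ hd).trans hdn⟩
  have hx : ∀ k, pedal^[k] p ∈ Rset (v k) := by
    intro k
    have h := hw ⟨k % n, Nat.mod_lt _ hn⟩
    rw [hwd] at h
    simpa only [hper'.iterate_mod_apply, Nat.mod_mod_of_dvd k hdvd] using h
  have hy : ∀ k, pedal^[k] (pedal^[d] p) ∈ Rset (v k) := by
    intro k
    have h := hx (k + d)
    simpa only [v, Function.iterate_add_apply, Nat.add_mod_right] using h
  have hdist := sqDist_iterate_pedal v hx hy n
  rw [← Function.iterate_add_apply, add_comm, Function.iterate_add_apply, hper] at hdist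
  have hpow : (1 : ℝ) < 4 ^ n := one_lt_pow₀ (by norm_num) (by omega)
  have hzero : sqDist p (pedal^[d] p) = 0 := by
    have h : ((4 : ℝ) ^ n - 1) * sqDist p (pedal^[d] p) = 0 := by linarith
    exact (mul_eq_zero.mp h).resolve_left (by linarith)
  exact hmin d hd hdn (eq_of_sqDist_eq_zero hzero).symm
end
end
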